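/- Let k ≥ 1 be an integer, let W be a random variable with E[W] = 0, E[W²] = 2b² ∈ (0,∞) and E[|W|^{k+2}] < ∞, let W^L (defined on the same probability space) have the centered equilibrium distribution with respect to W, and let Z ~ Laplace(0,b). Then d_K(W, Z) ≤ 11.56 · ( E[|W − W^L|^k] / b^k )^{1/(k+1)}. -/

import Mathlib

open MeasureTheory ProbabilityTheory Real Set

/-- The Laplace(0,b) distribution on ℝ, with density (1/(2b))·exp(−|x|/b). -/
noncomputable def laplaceDist (b : ℝ) : Measure ℝ :=
  (volume : Measure ℝ).withDensity fun x => ENNReal.ofReal (Real.exp (-|x| / b) / (2 * b))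

/-- Kolmogorov distance between two laws on ℝ. -/
noncomputable def kolDist (μ ν : Measure ℝ) : ℝ :=
  ⨆ z : ℝ, |(μ (Iic z)).toReal - (ν (Iic z)).toReal|

/-- Wasserstein distance between two laws on ℝ: sup over 1-Lipschitz test functions. -/
noncomputable def wassDist (μ ν : Measure ℝ) : ℝ :=
  ⨆ h : {h : ℝ → ℝ // LipschitzWith 1 h}, |(∫ x, h.1 x ∂μ) - ∫ x, h.1 x ∂ν|

/-- d₂ distance: sup over differentiable h with 1-Lipschitz derivative. -/
noncomputable def d2Dist (μ ν : Measure ℝ) : ℝ :=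
  ⨆ h : {h : ℝ → ℝ // Differentiable ℝ h ∧ LipschitzWith 1 (deriv h)},
    |(∫ x, h.1 x ∂μ) - ∫ x, h.1 x ∂ν|

/-- d₁,₂ distance: sup over differentiable h with ‖h'‖∞ ≤ 1 and 1-Lipschitz derivative. -/
noncomputable def d12Dist (μ ν : Measure ℝ) : ℝ :=
  ⨆ h : {h : ℝ → ℝ //
      Differentiable ℝ h ∧ (∀ x, |deriv h x| ≤ 1) ∧ LipschitzWith 1 (deriv h)},
    |(∫ x, h.1 x ∂μ) - ∫ x, h.1 x ∂ν|

/-- The Beta(1,m) distribution on ℝ, with density m(1−x)^{m−1} on (0,1). -/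
noncomputable def betaOneDist (m : ℕ) : Measure ℝ :=
  (volume : Measure ℝ).withDensity fun x =>
    ENNReal.ofReal (if 0 < x ∧ x < 1 then m * (1 - x) ^ (m - 1) else 0)

/-- `WL` has the centered equilibrium distribution with respect to `W`:
`E[f(W)] − f(0) = (1/2)·E[W²]·E[f''(WL)]` for all twice differentiable `f` such that
`E|f(W)| < ∞` and `E|W f'(W)| < ∞` (and `f''(WL)` is integrable). -/
def IsCenteredEquilibrium {Ω : Type*} [MeasureSpace Ω] (W WL : Ω → ℝ) : Prop :=
  ∀ f : ℝ → ℝ, Differentiable ℝ f → Differentiable ℝ (deriv f) →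
    Integrable (fun ω => f (W ω)) → Integrable (fun ω => W ω * deriv f (W ω)) →
    Integrable (fun ω => deriv (deriv f) (WL ω)) →
    (∫ ω, f (W ω)) - f 0 = (1 / 2) * (∫ ω, (W ω) ^ 2) * ∫ ω, deriv (deriv f) (WL ω)

/-- The cumulative distribution function of the Laplace(0,b) distribution. -/
noncomputable def laplaceCdf (b x : ℝ) : ℝ :=
  if x ≤ 0 then exp (x / b) / 2 else 1 - exp (-x / b) / 2

/-- An antiderivative of `laplaceCdf b`. -/
noncomputable def laplaceCdfPrimitive (b x : ℝ) : ℝ :=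
  max x 0 + b / 2 * exp (-|x| / b)

lemma continuous_laplaceCdf (b : ℝ) : Continuous (laplaceCdf b) := by
  unfold laplaceCdf
  refine Continuous.if_le (by fun_prop) (by fun_prop) (by fun_prop) (by fun_prop) ?_
  rintro x rfl
  norm_num

lemma hasDerivAt_laplaceCdf (b x : ℝ) :
    HasDerivAt (laplaceCdf b) (exp (-|x| / b) / (2 * b)) x := by
  refine hasDerivAt_of_hasDerivAt_of_ne' (x := 0)
    (g := fun x => exp (-|x| / b) / (2 * b)) ?_ (continuous_laplaceCdf b).continuousAt
    (by fun_prop) x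
  intro y hy
  rcases lt_or_gt_of_ne hy with h | h
  · have h1 : HasDerivAt (fun x => exp (x / b) / 2) (exp (y / b) * (1 / b) / 2) y :=
      ((hasDerivAt_id' y).div_const b).exp.div_const 2
    rw [abs_of_neg h, neg_neg]
    refine (h1.congr_deriv (by ring)).congr_of_eventuallyEq ?_
    filter_upwards [eventually_lt_nhds h] with t ht
    simp [laplaceCdf, ht.le]
  · have h1 : HasDerivAt (fun x => 1 - exp (-x / b) / 2) (-(exp (-y / b) * (-1 / b) / 2)) y :=
      (((hasDerivAt_neg y).div_const b).exp.div_const 2).const_sub 1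
    rw [abs_of_pos h]
    refine (h1.congr_deriv (by ring)).congr_of_eventuallyEq ?_
    filter_upwards [eventually_gt_nhds h] with t ht
    simp [laplaceCdf, ht.not_ge]

lemma hasDerivAt_laplaceCdfPrimitive {b : ℝ} (hb : b ≠ 0) (x : ℝ) :
    HasDerivAt (laplaceCdfPrimitive b) (laplaceCdf b x) x := by
  refine hasDerivAt_of_hasDerivAt_of_ne' (x := 0) ?_ ?_ (continuous_laplaceCdf b).continuousAt x
  swap
  · unfold laplaceCdfPrimitive
    fun_prop
  intro y hy
  rcases lt_or_gt_of_ne hy with h | h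
  · have h1 : HasDerivAt (fun x => b / 2 * exp (x / b)) (b / 2 * (exp (y / b) * (1 / b))) y :=
      ((hasDerivAt_id' y).div_const b).exp.const_mul _
    rw [laplaceCdf, if_pos h.le]
    refine (h1.congr_deriv (by field_simp)).congr_of_eventuallyEq ?_
    filter_upwards [eventually_lt_nhds h] with t ht
    simp [laplaceCdfPrimitive, ht.le, abs_of_neg ht]
  · have h1 : HasDerivAt (fun x => x + b / 2 * exp (-x / b))
        (1 + b / 2 * (exp (-y / b) * (-1 / b))) y :=
      (hasDerivAt_id' y).add (((hasDerivAt_neg y).div_const b).exp.const_mul _)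
    rw [laplaceCdf, if_neg h.not_ge]
    refine (h1.congr_deriv (by field_simp; ring)).congr_of_eventuallyEq ?_
    filter_upwards [eventually_gt_nhds h] with t ht
    simp [laplaceCdfPrimitive, ht.le, abs_of_pos ht]

lemma laplacePdf_nonneg {b : ℝ} (hb : 0 < b) (x : ℝ) : 0 ≤ exp (-|x| / b) / (2 * b) := by
  positivity

lemma laplacePdf_le {b : ℝ} (hb : 0 < b) (x : ℝ) :
    exp (-|x| / b) / (2 * b) ≤ 1 / (2 * b) := by
  gcongr
  exact exp_le_one_iff.2 (div_nonpos_of_nonpos_of_nonneg (by simp) hb.le)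

lemma monotone_laplaceCdf {b : ℝ} (hb : 0 < b) : Monotone (laplaceCdf b) :=
  monotone_of_hasDerivAt_nonneg (hasDerivAt_laplaceCdf b) (laplacePdf_nonneg hb)

lemma laplaceCdf_nonneg {b : ℝ} (hb : 0 < b) (x : ℝ) : 0 ≤ laplaceCdf b x := by
  unfold laplaceCdf
  split_ifs with h
  · positivity
  · have : exp (-x / b) ≤ 1 :=
      exp_le_one_iff.2 (div_nonpos_of_nonpos_of_nonneg (by linarith) hb.le)
    linarith

lemma laplaceCdf_le_one {b : ℝ} (hb : 0 < b) (x : ℝ) : laplaceCdf b x ≤ 1 := by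
  unfold laplaceCdf
  split_ifs with h
  · have : exp (x / b) ≤ 1 := exp_le_one_iff.2 (div_nonpos_of_nonpos_of_nonneg h hb.le)
    linarith
  · linarith [exp_pos (-x / b)]

lemma abs_laplaceCdf_sub_le {b : ℝ} (hb : 0 < b) (x y : ℝ) :
    |laplaceCdf b y - laplaceCdf b x| ≤ 1 / (2 * b) * |y - x| :=
  convex_univ.norm_image_sub_le_of_norm_hasDerivWithin_le
    (fun t _ => (hasDerivAt_laplaceCdf b t).hasDerivWithinAt)
    (fun t _ => by
      rw [norm_of_nonneg (laplacePdf_nonneg hb t)]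
      exact laplacePdf_le hb t) (mem_univ x) (mem_univ y)

lemma tendsto_laplaceCdf_atBot {b : ℝ} (hb : 0 < b) :
    Filter.Tendsto (laplaceCdf b) Filter.atBot (nhds 0) := by
  have h : Filter.Tendsto (fun x : ℝ => exp (x / b) / 2) Filter.atBot (nhds (0 / 2)) :=
    (tendsto_exp_atBot.comp (Filter.tendsto_id.atBot_div_const hb)).div_const 2
  rw [zero_div] at h
  refine h.congr' ?_
  filter_upwards [Filter.eventually_le_atBot 0] with x hx
  simp [laplaceCdf, hx]

lemma integrable_laplacePdf {b : ℝ} (hb : 0 < b) :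
    Integrable (fun x : ℝ => exp (-|x| / b) / (2 * b)) := by
  refine Integrable.div_const ?_ _
  rw [← integrableOn_univ, ← Iic_union_Ioi (a := (0 : ℝ))]
  refine IntegrableOn.union ?_ ?_
  · refine (integrableOn_exp_mul_Iic (inv_pos.2 hb) 0).congr_fun (fun x hx => ?_) measurableSet_Iic
    simp only [abs_of_nonpos (mem_Iic.1 hx)]
    ring_nf
  · refine (integrableOn_exp_mul_Ioi (neg_lt_zero.2 (inv_pos.2 hb)) 0).congr_fun
      (fun x hx => ?_) measurableSet_Ioi
    simp only [abs_of_pos (mem_Ioi.1 hx)]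
    ring_nf

lemma laplaceDist_Iic {b : ℝ} (hb : 0 < b) (z : ℝ) :
    (laplaceDist b (Iic z)).toReal = laplaceCdf b z := by
  have hint := integrable_laplacePdf hb
  rw [laplaceDist, withDensity_apply _ measurableSet_Iic,
    ← ofReal_integral_eq_lintegral_ofReal hint.integrableOn
      (Filter.Eventually.of_forall (laplacePdf_nonneg hb)),
    integral_Iic_of_hasDerivAt_of_tendsto' (fun x _ => hasDerivAt_laplaceCdf b x)
      hint.integrableOn (tendsto_laplaceCdf_atBot hb), sub_zero,
    ENNReal.toReal_ofReal (laplaceCdf_nonneg hb z)]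

/-- The continuous piecewise linear function equal to `1` on `(-∞, z]` and `0` on `[z + a, ∞)`. -/
noncomputable def ramp (z a w : ℝ) : ℝ :=
  (max (z + a - w) 0 - max (z - w) 0) / a

/-- The solution of the Laplace Stein equation `f - b² f'' = ramp z a`. -/
noncomputable def rampSolution (b z a w : ℝ) : ℝ :=
  (laplaceCdfPrimitive b (z + a - w) - laplaceCdfPrimitive b (z - w)) / a

lemma continuous_ramp (z a : ℝ) : Continuous (ramp z a) := by
  unfold ramp
  fun_prop

lemma ramp_nonneg {a : ℝ} (ha : 0 < a) (z w : ℝ) : 0 ≤ ramp z a w := by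
  refine div_nonneg (sub_nonneg.2 ?_) ha.le
  gcongr
  linarith

lemma ramp_le_one {a : ℝ} (ha : 0 < a) (z w : ℝ) : ramp z a w ≤ 1 := by
  rw [ramp, div_le_one ha, sub_le_iff_le_add]
  refine max_le ?_ ?_
  · linarith [le_max_left (z - w) 0]
  · linarith [le_max_right (z - w) 0]

lemma ramp_of_le {a z w : ℝ} (ha : 0 < a) (hw : w ≤ z) : ramp z a w = 1 := by
  rw [ramp, max_eq_left (by linarith), max_eq_left (by linarith), div_eq_one_iff_eq ha.ne']
  ring

lemma ramp_of_ge {a z w : ℝ} (ha : 0 < a) (hw : z + a ≤ w) : ramp z a w = 0 := by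
  rw [ramp, max_eq_right (by linarith), max_eq_right (by linarith), sub_zero, zero_div]

lemma hasDerivAt_rampSolution {b : ℝ} (hb : b ≠ 0) (z a w : ℝ) :
    HasDerivAt (rampSolution b z a) ((laplaceCdf b (z - w) - laplaceCdf b (z + a - w)) / a) w := by
  have h (c : ℝ) : HasDerivAt (fun w => laplaceCdfPrimitive b (c - w))
      (-laplaceCdf b (c - w)) w := (hasDerivAt_laplaceCdfPrimitive hb (c - w)).comp_const_sub c w
  exact (((h (z + a)).sub (h z)).div_const a).congr_deriv (by ring)

lemma hasDerivAt_deriv_rampSolution {b : ℝ} (hb : b ≠ 0) (z a w : ℝ) :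
    HasDerivAt (deriv (rampSolution b z a)) ((rampSolution b z a w - ramp z a w) / b ^ 2) w := by
  have h (c : ℝ) : HasDerivAt (fun w => laplaceCdf b (c - w))
      (-(exp (-|c - w| / b) / (2 * b))) w := (hasDerivAt_laplaceCdf b (c - w)).comp_const_sub c w
  rw [funext fun w => (hasDerivAt_rampSolution hb z a w).deriv]
  refine (((h z).sub (h (z + a))).div_const a).congr_deriv ?_
  simp only [rampSolution, ramp, laplaceCdfPrimitive]
  field_simp
  ring

lemma rampSolution_mem_Icc {a b : ℝ} (ha : 0 < a) (hb : 0 < b) (z w : ℝ) :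
    rampSolution b z a w ∈ Icc (laplaceCdf b (z - w)) (laplaceCdf b (z + a - w)) := by
  have hderiv := hasDerivAt_laplaceCdfPrimitive hb.ne'
  obtain ⟨c, hc, hc'⟩ := exists_hasDerivAt_eq_slope (laplaceCdfPrimitive b) (laplaceCdf b)
    (show z - w < z + a - w by linarith)
    (fun x _ => (hderiv x).continuousAt.continuousWithinAt) (fun x _ => hderiv x)
  have : rampSolution b z a w = laplaceCdf b c := by
    rw [hc', rampSolution]
    congr 1
    ring
  rw [this]
  exact ⟨monotone_laplaceCdf hb hc.1.le, monotone_laplaceCdf hb hc.2.le⟩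

lemma rampSolution_nonneg {a b : ℝ} (ha : 0 < a) (hb : 0 < b) (z w : ℝ) :
    0 ≤ rampSolution b z a w :=
  (laplaceCdf_nonneg hb _).trans (rampSolution_mem_Icc ha hb z w).1

lemma rampSolution_le_one {a b : ℝ} (ha : 0 < a) (hb : 0 < b) (z w : ℝ) :
    rampSolution b z a w ≤ 1 :=
  (rampSolution_mem_Icc ha hb z w).2.trans (laplaceCdf_le_one hb _)

lemma continuous_rampSolution {b : ℝ} (hb : b ≠ 0) (z a : ℝ) : Continuous (rampSolution b z a) :=
  continuous_iff_continuousAt.2 fun w => (hasDerivAt_rampSolution hb z a w).continuousAt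

lemma abs_deriv_rampSolution_le {a b : ℝ} (ha : 0 < a) (hb : 0 < b) (z w : ℝ) :
    |deriv (rampSolution b z a) w| ≤ 1 / (2 * b) := by
  rw [(hasDerivAt_rampSolution hb.ne' z a w).deriv, abs_div, abs_of_pos ha, div_le_iff₀ ha]
  refine (abs_laplaceCdf_sub_le hb _ _).trans_eq ?_
  rw [show z - w - (z + a - w) = -a by ring, abs_neg, abs_of_pos ha]

lemma abs_rampSolution_sub_le {a b : ℝ} (ha : 0 < a) (hb : 0 < b) (z x y : ℝ) :
    |rampSolution b z a y - rampSolution b z a x| ≤ 1 / (2 * b) * |y - x| :=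
  convex_univ.norm_image_sub_le_of_norm_deriv_le
    (fun t _ => (hasDerivAt_rampSolution hb.ne' z a t).differentiableAt)
    (fun t _ => abs_deriv_rampSolution_le ha hb z t) (mem_univ x) (mem_univ y)

lemma Measurable.integrable_of_abs_le {Ω : Type*} [MeasurableSpace Ω] {μ : Measure Ω}
    [IsFiniteMeasure μ] {f : Ω → ℝ} (hf : Measurable f) {C : ℝ} (h : ∀ ω, |f ω| ≤ C) :
    Integrable f μ :=
  Integrable.of_bound hf.aestronglyMeasurable C (Filter.Eventually.of_forall h)

lemma integrable_abs_sub_pow {Ω : Type*} [MeasurableSpace Ω] {μ : Measure Ω} {k : ℕ}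
    {X Y : Ω → ℝ} (hX : Measurable X) (hY : Measurable Y)
    (hXk : Integrable (fun ω => |X ω| ^ k) μ) (hYk : Integrable (fun ω => |Y ω| ^ k) μ) :
    Integrable (fun ω => |X ω - Y ω| ^ k) μ := by
  refine ((hXk.add hYk).const_mul (2 ^ (k - 1))).mono' (by fun_prop)
    (Filter.Eventually.of_forall fun ω => ?_)
  rw [norm_of_nonneg (by positivity)]
  exact (pow_le_pow_left₀ (abs_nonneg _) (abs_sub _ _) k).trans
    (add_pow_le (abs_nonneg _) (abs_nonneg _) k)

lemma one_le_abs_pow_div {k : ℕ} {x β : ℝ} (hβ : 0 < β) (h : β ≤ |x|) : 1 ≤ |x| ^ k / β ^ k := by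
  rw [← div_pow]
  exact one_le_pow₀ ((one_le_div hβ).2 h)

section CenteredEquilibrium

variable {Ω : Type*} [MeasureSpace Ω] [IsProbabilityMeasure (volume : Measure Ω)] {W WL : Ω → ℝ}
  {b : ℝ} {k : ℕ}

lemma integrable_rampSolution_comp {X : Ω → ℝ} (hX : Measurable X) {a : ℝ} (ha : 0 < a)
    (hb : 0 < b) (z : ℝ) : Integrable fun ω => rampSolution b z a (X ω) :=
  ((continuous_rampSolution hb.ne' z a).measurable.comp hX).integrable_of_abs_le (C := 1)
    fun ω => abs_le.2 ⟨neg_one_lt_zero.le.trans (rampSolution_nonneg ha hb z (X ω)),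
      rampSolution_le_one ha hb z (X ω)⟩

lemma integrable_ramp_comp {X : Ω → ℝ} (hX : Measurable X) {a : ℝ} (ha : 0 < a) (z : ℝ) :
    Integrable fun ω => ramp z a (X ω) :=
  ((continuous_ramp z a).measurable.comp hX).integrable_of_abs_le (C := 1)
    fun ω => abs_le.2 ⟨neg_one_lt_zero.le.trans (ramp_nonneg ha z (X ω)), ramp_le_one ha z (X ω)⟩

lemma IsCenteredEquilibrium.integral_ramp (hCE : IsCenteredEquilibrium W WL)
    (hW : Measurable W) (hWL : Measurable WL) (hb : 0 < b) (hWint : Integrable W)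
    (hWvar : ∫ ω, (W ω) ^ 2 = 2 * b ^ 2) {a : ℝ} (ha : 0 < a) (z : ℝ) :
    ∫ ω, ramp z a (WL ω) = rampSolution b z a 0 +
      ∫ ω, (rampSolution b z a (WL ω) - rampSolution b z a (W ω)) := by
  have h2 : deriv (deriv (rampSolution b z a)) =
      fun w => (rampSolution b z a w - ramp z a w) / b ^ 2 :=
    funext fun w => (hasDerivAt_deriv_rampSolution hb.ne' z a w).deriv
  have hd : Differentiable ℝ (deriv (rampSolution b z a)) :=
    fun w => (hasDerivAt_deriv_rampSolution hb.ne' z a w).differentiableAt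
  have hiW := integrable_rampSolution_comp hW ha hb z
  have hiWL := integrable_rampSolution_comp hWL ha hb z
  have hiR := integrable_ramp_comp hWL ha z
  have key := hCE (rampSolution b z a)
    (fun w => (hasDerivAt_rampSolution hb.ne' z a w).differentiableAt) hd hiW
    (hWint.mul_bdd (c := 1 / (2 * b)) (hd.continuous.measurable.comp hW).aestronglyMeasurable
      (Filter.Eventually.of_forall fun ω => abs_deriv_rampSolution_le ha hb z (W ω)))
    (by rw [h2]; exact (hiWL.sub hiR).div_const _)
  rw [h2, hWvar, integral_div, integral_sub hiWL hiR] at key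
  rw [integral_sub hiWL hiW]
  field_simp at key
  linarith

lemma IsCenteredEquilibrium.integrable_abs_pow (hCE : IsCenteredEquilibrium W WL)
    (hW : Measurable W) (hWL : Measurable WL) (hb : 0 < b)
    (hWvar : ∫ ω, (W ω) ^ 2 = 2 * b ^ 2) (hWk : Integrable fun ω => |W ω| ^ (k + 2)) :
    Integrable fun ω => |WL ω| ^ k := by
  have bound (n : ℕ) : ∫ ω, min (|WL ω| ^ k) n ≤ (∫ ω, |W ω| ^ (k + 2)) / b ^ 2 := by
    let g : ℝ → ℝ := fun t => min (|t| ^ k) n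
    let F : ℝ → ℝ := fun w => ∫ t in (0 : ℝ)..w, g t
    let f : ℝ → ℝ := fun w => ∫ t in (0 : ℝ)..w, F t
    have hg : Continuous g := by fun_prop
    have hg0 (t : ℝ) : 0 ≤ g t := le_min (by positivity) (by positivity)
    have hF (w : ℝ) : HasDerivAt F (g w) w := hg.integral_hasStrictDerivAt 0 w |>.hasDerivAt
    have hFc : Continuous F := continuous_iff_continuousAt.2 fun w => (hF w).continuousAt
    have hf (w : ℝ) : HasDerivAt f (F w) w := hFc.integral_hasStrictDerivAt 0 w |>.hasDerivAt
    have hfc : Continuous f := continuous_iff_continuousAt.2 fun w => (hf w).continuousAt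
    have hf1 : deriv f = F := funext fun w => (hf w).deriv
    have hf2 : deriv F = g := funext fun w => (hF w).deriv
    have habs {t w : ℝ} (ht : t ∈ uIoc 0 w) : |t| ≤ |w| := by
      have := abs_sub_left_of_mem_uIcc (uIoc_subset_uIcc ht)
      simpa using this
    have hFle (w : ℝ) : |F w| ≤ |w| ^ (k + 1) := by
      have := intervalIntegral.norm_integral_le_of_norm_le_const (a := 0) (b := w) (f := g)
        (C := |w| ^ k) fun t ht => by
          rw [norm_of_nonneg (hg0 t)]
          exact (min_le_left _ _).trans (pow_le_pow_left₀ (abs_nonneg _) (habs ht) k)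
      simpa [pow_succ] using this
    have hfle (w : ℝ) : |f w| ≤ |w| ^ (k + 2) := by
      have := intervalIntegral.norm_integral_le_of_norm_le_const (a := 0) (b := w) (f := F)
        (C := |w| ^ (k + 1)) fun t ht =>
          (hFle t).trans (pow_le_pow_left₀ (abs_nonneg _) (habs ht) _)
      simpa [pow_succ] using this
    have hfW : Integrable fun ω => f (W ω) :=
      hWk.mono' (hfc.measurable.comp hW).aestronglyMeasurable
        (Filter.Eventually.of_forall fun ω => hfle (W ω))
    have key := hCE f (fun w => (hf w).differentiableAt)
      (by rw [hf1]; exact fun w => (hF w).differentiableAt) hfW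
      (by
        rw [hf1]
        refine hWk.mono' (hW.mul (hFc.measurable.comp hW)).aestronglyMeasurable
          (Filter.Eventually.of_forall fun ω => ?_)
        rw [norm_mul, norm_eq_abs, norm_eq_abs, pow_succ' _ (k + 1)]
        exact mul_le_mul_of_nonneg_left (hFle _) (abs_nonneg _))
      (by
        rw [hf1, hf2]
        exact (hg.measurable.comp hWL).integrable_of_abs_le (C := n) fun ω => by
          exact (abs_of_nonneg (hg0 (WL ω))).trans_le (min_le_right _ _))
    rw [hf1, hf2, hWvar, show f 0 = 0 from intervalIntegral.integral_same] at key
    have hle : ∫ ω, f (W ω) ≤ ∫ ω, |W ω| ^ (k + 2) :=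
      integral_mono hfW hWk fun ω => (le_abs_self _).trans (hfle _)
    rw [le_div_iff₀ (by positivity)]
    change (∫ ω, g (WL ω)) * b ^ 2 ≤ _
    linarith
  have hmeas : Measurable fun ω => |WL ω| ^ k := by fun_prop
  refine ⟨hmeas.aestronglyMeasurable, ?_⟩
  rw [hasFiniteIntegral_iff_ofReal (Filter.Eventually.of_forall fun ω => by positivity)]
  have hmeas' (n : ℕ) : Measurable fun ω => min (|WL ω| ^ k) (n : ℝ) := by fun_prop
  have hlim : ∀ ω, Filter.Tendsto (fun n : ℕ => ENNReal.ofReal (min (|WL ω| ^ k) n)) Filter.atTop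
      (nhds (ENNReal.ofReal (|WL ω| ^ k))) := fun ω => by
    refine tendsto_const_nhds.congr' ?_
    filter_upwards [Filter.eventually_ge_atTop ⌈|WL ω| ^ k⌉₊] with n hn
    rw [min_eq_left (Nat.ceil_le.1 hn)]
  calc ∫⁻ ω, ENNReal.ofReal (|WL ω| ^ k)
      = ∫⁻ ω, Filter.liminf (fun n : ℕ => ENNReal.ofReal (min (|WL ω| ^ k) n)) Filter.atTop := by
        simp only [(hlim _).liminf_eq]
    _ ≤ Filter.liminf (fun n : ℕ => ∫⁻ ω, ENNReal.ofReal (min (|WL ω| ^ k) n)) Filter.atTop :=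
        lintegral_liminf_le fun n => (hmeas' n).ennreal_ofReal
    _ ≤ ENNReal.ofReal ((∫ ω, |W ω| ^ (k + 2)) / b ^ 2) := by
        refine Filter.liminf_le_of_frequently_le' (Filter.Frequently.of_forall fun n => ?_)
        have h0 (ω : Ω) : 0 ≤ min (|WL ω| ^ k) (n : ℝ) := le_min (by positivity) (by positivity)
        rw [← ofReal_integral_eq_lintegral_ofReal
          ((hmeas' n).integrable_of_abs_le (C := n) fun ω => by
            simp [abs_of_nonneg (h0 ω)])
          (Filter.Eventually.of_forall h0)]
        exact ENNReal.ofReal_le_ofReal (bound n)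
    _ < ⊤ := ENNReal.ofReal_lt_top

lemma abs_integral_rampSolution_sub_le (hb : 0 < b)
    (hD : Integrable fun ω => |W ω - WL ω| ^ k) {a β : ℝ} (ha : 0 < a) (hβ : 0 < β) (z : ℝ) :
    |∫ ω, (rampSolution b z a (WL ω) - rampSolution b z a (W ω))| ≤
      β / (2 * b) + (∫ ω, |W ω - WL ω| ^ k) / β ^ k := by
  have hi : Integrable fun ω => β / (2 * b) + |W ω - WL ω| ^ k / β ^ k :=
    (integrable_const _).add (hD.div_const _)
  calc |∫ ω, (rampSolution b z a (WL ω) - rampSolution b z a (W ω))|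
      ≤ ∫ ω, (β / (2 * b) + |W ω - WL ω| ^ k / β ^ k) := by
        rw [← norm_eq_abs]
        refine norm_integral_le_of_norm_le hi (Filter.Eventually.of_forall fun ω => ?_)
        rw [norm_eq_abs]
        rcases le_total |W ω - WL ω| β with h | h
        · have h1 := abs_rampSolution_sub_le ha hb z (W ω) (WL ω)
          rw [abs_sub_comm (WL ω)] at h1
          have h2 : 1 / (2 * b) * |W ω - WL ω| ≤ 1 / (2 * b) * β := by gcongr
          have h3 : 0 ≤ |W ω - WL ω| ^ k / β ^ k := by positivity
          have h4 : 1 / (2 * b) * β = β / (2 * b) := by ring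
          linarith
        · have h1 := one_le_abs_pow_div (k := k) hβ h
          have h2 : 0 ≤ β / (2 * b) := by positivity
          rw [abs_le]
          constructor <;> linarith [rampSolution_nonneg ha hb z (W ω),
            rampSolution_nonneg ha hb z (WL ω), rampSolution_le_one ha hb z (W ω),
            rampSolution_le_one ha hb z (WL ω)]
    _ = _ := by
        rw [integral_add (integrable_const _) (hD.div_const _), integral_const,
          integral_div (β ^ k)]
        simp

lemma IsCenteredEquilibrium.abs_cdf_sub_laplaceCdf_le (hCE : IsCenteredEquilibrium W WL)
    (hW : Measurable W) (hWL : Measurable WL) (hb : 0 < b) (hWint : Integrable W)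
    (hWvar : ∫ ω, (W ω) ^ 2 = 2 * b ^ 2) (hD : Integrable fun ω => |W ω - WL ω| ^ k)
    {β : ℝ} (hβ : 0 < β) (z : ℝ) :
    |(Measure.map W volume (Iic z)).toReal - laplaceCdf b z| ≤
      3 / 2 * (β / b) + 2 * ((∫ ω, |W ω - WL ω| ^ k) / β ^ k) := by
  have hset : MeasurableSet (W ⁻¹' Iic z) := hW measurableSet_Iic
  have hcdf : (Measure.map W volume (Iic z)).toReal =
      ∫ ω, (W ⁻¹' Iic z).indicator (fun _ => (1 : ℝ)) ω := by
    rw [Measure.map_apply hW measurableSet_Iic]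
    exact (integral_indicator_one hset).symm
  have hI : Integrable ((W ⁻¹' Iic z).indicator fun _ => (1 : ℝ)) :=
    (integrable_const _).indicator hset
  have hDβ := hD.div_const (β ^ k)
  have upper : (Measure.map W volume (Iic z)).toReal ≤
      (∫ ω, ramp (z + β) β (WL ω)) + (∫ ω, |W ω - WL ω| ^ k) / β ^ k := by
    have hR := integrable_ramp_comp hWL hβ (z + β)
    rw [hcdf, ← integral_div, ← integral_add hR hDβ]
    refine integral_mono hI (hR.add hDβ) fun ω => ?_
    have h0 := ramp_nonneg hβ (z + β) (WL ω)
    have h1 : 0 ≤ |W ω - WL ω| ^ k / β ^ k := by positivity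
    change (W ⁻¹' Iic z).indicator _ ω ≤ ramp (z + β) β (WL ω) + |W ω - WL ω| ^ k / β ^ k
    by_cases hz : W ω ≤ z
    · rw [indicator_of_mem (show ω ∈ W ⁻¹' Iic z from hz)]
      rcases le_total |W ω - WL ω| β with h | h
      · rw [ramp_of_le hβ (by linarith [(abs_le.1 h).1])]
        linarith
      · linarith [one_le_abs_pow_div (k := k) hβ h]
    · rw [indicator_of_notMem (show ω ∉ W ⁻¹' Iic z from hz)]
      linarith
  have lower : (∫ ω, ramp (z - 2 * β) β (WL ω)) ≤
      (Measure.map W volume (Iic z)).toReal + (∫ ω, |W ω - WL ω| ^ k) / β ^ k := by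
    have hR := integrable_ramp_comp hWL hβ (z - 2 * β)
    rw [hcdf, ← integral_div, ← integral_add hI hDβ]
    refine integral_mono hR (hI.add hDβ) fun ω => ?_
    have h0 := ramp_le_one hβ (z - 2 * β) (WL ω)
    have h1 : 0 ≤ |W ω - WL ω| ^ k / β ^ k := by positivity
    change ramp (z - 2 * β) β (WL ω) ≤ (W ⁻¹' Iic z).indicator _ ω + |W ω - WL ω| ^ k / β ^ k
    by_cases hz : W ω ≤ z
    · rw [indicator_of_mem (show ω ∈ W ⁻¹' Iic z from hz)]
      linarith
    · rw [indicator_of_notMem (show ω ∉ W ⁻¹' Iic z from hz)]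
      rcases le_total |W ω - WL ω| β with h | h
      · rw [ramp_of_ge hβ (by linarith [(abs_le.1 h).2])]
        linarith
      · linarith [one_le_abs_pow_div (k := k) hβ h]
  rw [hCE.integral_ramp hW hWL hb hWint hWvar hβ] at upper lower
  have hu := (abs_le.1 (abs_integral_rampSolution_sub_le hb hD hβ hβ (z + β))).2
  have hl := (abs_le.1 (abs_integral_rampSolution_sub_le hb hD hβ hβ (z - 2 * β))).1
  have hfu := (rampSolution_mem_Icc hβ hb (z + β) 0).2
  have hfl := (rampSolution_mem_Icc hβ hb (z - 2 * β) 0).1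
  rw [sub_zero] at hfu hfl
  have hLu := (abs_le.1 (abs_laplaceCdf_sub_le hb z (z + β + β))).2
  have hLl := (abs_le.1 (abs_laplaceCdf_sub_le hb z (z - 2 * β))).1
  rw [show z + β + β - z = 2 * β by ring, abs_of_pos (by positivity)] at hLu
  rw [show z - 2 * β - z = -(2 * β) by ring, abs_neg, abs_of_pos (by positivity)] at hLl
  have e1 : 1 / (2 * b) * (2 * β) = β / b := by field_simp
  have e2 : β / (2 * b) = 1 / 2 * (β / b) := by field_simp
  rw [abs_le]
  constructor <;> linarith

end CenteredEquilibrium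

lemma le_of_forall_pos_le_add_div_pow {x b M : ℝ} (hb : 0 < b) (hM : 0 ≤ M) (k : ℕ)
    (h : ∀ β, 0 < β → x ≤ 3 / 2 * (β / b) + 2 * (M / β ^ k)) :
    x ≤ 11.56 * (M / b ^ k) ^ ((1 : ℝ) / ((k : ℝ) + 1)) := by
  have hk : (k : ℝ) + 1 ≠ 0 := by positivity
  rcases hM.eq_or_lt with rfl | hM
  · rw [zero_div, zero_rpow (one_div_ne_zero hk), mul_zero]
    refine le_of_forall_pos_le_add fun ε hε => ?_
    have := h (2 / 3 * ε * b) (by positivity)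
    rw [zero_div, mul_zero, mul_div_cancel_right₀ _ hb.ne'] at this
    linarith
  · set ρ := (M / b ^ k) ^ ((1 : ℝ) / ((k : ℝ) + 1)) with hρ
    have hρ0 : 0 < ρ := by positivity
    have hpow : ρ ^ (k + 1) = M / b ^ k := by
      rw [hρ, ← rpow_natCast, ← rpow_mul (by positivity)]
      push_cast
      rw [one_div_mul_cancel hk, rpow_one]
    have h1 := h (b * ρ) (by positivity)
    have h2 : M / (b * ρ) ^ k = ρ := by
      rw [mul_pow, ← div_div, ← hpow, pow_succ]
      field_simp
    rw [h2, mul_div_cancel_left₀ _ hb.ne'] at h1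
    linarith

/-- Theorem 2.4: Laplace approximation bounds via the centered equilibrium distribution. -/
theorem centered_equilibrium_kolmogorov_moment
    {Ω : Type*} [MeasureSpace Ω] [IsProbabilityMeasure (volume : Measure Ω)]
    (W WL : Ω → ℝ) (hWmeas : Measurable W) (hWLmeas : Measurable WL)
    (b : ℝ) (hb : 0 < b)
    (hWmean : ∫ ω, W ω = 0)
    (hWsqInt : Integrable fun ω => (W ω) ^ 2)
    (hWvar : ∫ ω, (W ω) ^ 2 = 2 * b ^ 2)
    (hCE : IsCenteredEquilibrium W WL)
    (k : ℕ) (hk : 1 ≤ k)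
    (hWk2Int : Integrable fun ω => |W ω| ^ (k + 2)) :
    kolDist (Measure.map W volume) (laplaceDist b) ≤
      11.56 * ((∫ ω, |W ω - WL ω| ^ k) / b ^ k) ^ ((1 : ℝ) / ((k : ℝ) + 1)) := by
  have hW1 : Integrable W :=
    ((memLp_two_iff_integrable_sq hWmeas.aestronglyMeasurable).2 hWsqInt).integrable (by norm_num)
  have hWk : Integrable fun ω => |W ω| ^ k := by
    refine ((integrable_const 1).add hWk2Int).mono' (by fun_prop)
      (Filter.Eventually.of_forall fun ω => ?_)
    rw [norm_of_nonneg (by positivity)]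
    change |W ω| ^ k ≤ 1 + |W ω| ^ (k + 2)
    rcases le_total |W ω| 1 with h | h
    · linarith [pow_le_one₀ (n := k) (abs_nonneg _) h, pow_nonneg (abs_nonneg (W ω)) (k + 2)]
    · linarith [pow_le_pow_right₀ h (show k ≤ k + 2 by omega)]
  have hD := integrable_abs_sub_pow hWmeas hWLmeas hWk
    (hCE.integrable_abs_pow hWmeas hWLmeas hb hWvar hWk2Int)
  refine ciSup_le fun z => ?_
  rw [laplaceDist_Iic hb]
  exact le_of_forall_pos_le_add_div_pow hb (integral_nonneg fun ω => by positivity) k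
    fun β hβ => hCE.abs_cdf_sub_laplaceCdf_le hWmeas hWLmeas hb hW1 hWvar hD hβ z
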